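/- Let n ≥ 1, 1 < p < ∞, 0 < q < p−1, 0 < α < n/p, and r > n(p−1)/(n−αp). Then there exist constants 0 < c ≤ C, depending only on α, p, q, r, n (not on σ), such that for every locally finite nonnegative Borel measure σ on ℝⁿ, c·∫_{ℝⁿ} sup_{Q ∈ 𝒬 : x ∈ Q} ( κ(Q)^{q(p−1)/(p−1−q)} / |Q|^{1−αp/n} )^{r/(p−1)} dx ≤ ∫_{ℝⁿ} ( K^d_{α,p,q}σ(x) )^{r} dx ≤ C·∫_{ℝⁿ} sup_{Q ∈ 𝒬 : x ∈ Q} ( κ(Q)^{q(p−1)/(p−1−q)} / |Q|^{1−αp/n} )^{r/(p−1)} dx. -/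

import Mathlib

open MeasureTheory Metric Set
open scoped ENNReal NNReal

/-- The Wolff potential `W_{α,p}ν(x) = ∫₀^∞ (ν(B(x,ρ))/ρ^{n−αp})^{1/(p−1)} dρ/ρ`. -/
noncomputable def wolffPot (n : ℕ) (α p : ℝ)
    (ν : Measure (EuclideanSpace ℝ (Fin n))) (x : EuclideanSpace ℝ (Fin n)) : ℝ≥0∞ :=
  ∫⁻ ρ in Set.Ioi (0 : ℝ),
    (ν (Metric.ball x ρ) / ENNReal.ofReal (ρ ^ ((n : ℝ) - α * p))) ^ (1 / (p - 1)) /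
      ENNReal.ofReal ρ

/-- The least constant `κ(E)` such that
`(∫_E (W_{α,p}ν)^q dσ)^{1/q} ≤ κ · ν(ℝⁿ)^{1/(p−1)}` for all finite measures `ν`. -/
noncomputable def embC (n : ℕ) (α p q : ℝ) (σ : Measure (EuclideanSpace ℝ (Fin n)))
    (E : Set (EuclideanSpace ℝ (Fin n))) : ℝ≥0∞ :=
  sInf {κ : ℝ≥0∞ | ∀ ν : Measure (EuclideanSpace ℝ (Fin n)), IsFiniteMeasure ν →
    (∫⁻ y in E, wolffPot n α p ν y ^ q ∂σ) ^ (1 / q) ≤ κ * (ν Set.univ) ^ (1 / (p - 1))}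

/-- The intrinsic potential of Wolff type
`K_{α,p,q}σ(x) = ∫₀^∞ (κ(B(x,ρ))^{q(p−1)/(p−1−q)}/ρ^{n−αp})^{1/(p−1)} dρ/ρ`. -/
noncomputable def intK (n : ℕ) (α p q : ℝ) (σ : Measure (EuclideanSpace ℝ (Fin n)))
    (x : EuclideanSpace ℝ (Fin n)) : ℝ≥0∞ :=
  ∫⁻ ρ in Set.Ioi (0 : ℝ),
    (embC n α p q σ (Metric.ball x ρ) ^ (q * (p - 1) / (p - 1 - q)) /
      ENNReal.ofReal (ρ ^ ((n : ℝ) - α * p))) ^ (1 / (p - 1)) / ENNReal.ofReal ρ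

/-- The half-open dyadic cube `2^{−k}(m + [0,1)ⁿ)`. -/
def dyadicCube (n : ℕ) (k : ℤ) (m : Fin n → ℤ) : Set (EuclideanSpace ℝ (Fin n)) :=
  {x | ∀ i : Fin n, (m i : ℝ) * (2 : ℝ) ^ (-k) ≤ x i ∧ x i < ((m i : ℝ) + 1) * (2 : ℝ) ^ (-k)}

/-- The dyadic intrinsic potential
`K^d_{α,p,q}σ(x) = Σ_{Q ∈ 𝒬} (κ(Q)^{q(p−1)/(p−1−q)}/|Q|^{1−αp/n})^{1/(p−1)} χ_Q(x)`. -/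
noncomputable def intKd (n : ℕ) (α p q : ℝ) (σ : Measure (EuclideanSpace ℝ (Fin n)))
    (x : EuclideanSpace ℝ (Fin n)) : ℝ≥0∞ :=
  ∑' km : ℤ × (Fin n → ℤ),
    Set.indicator (dyadicCube n km.1 km.2)
      (fun _ => (embC n α p q σ (dyadicCube n km.1 km.2) ^ (q * (p - 1) / (p - 1 - q)) /
        volume (dyadicCube n km.1 km.2) ^ (1 - α * p / (n : ℝ))) ^ (1 / (p - 1))) x

section Superadditivity

variable {n : ℕ} {α p q : ℝ} {σ : Measure (EuclideanSpace ℝ (Fin n))}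

lemma wolffPot_mono {ν ν' : Measure (EuclideanSpace ℝ (Fin n))} (hp : 1 < p) (h : ν ≤ ν')
    (x : EuclideanSpace ℝ (Fin n)) : wolffPot n α p ν x ≤ wolffPot n α p ν' x := by
  have hs : 0 ≤ 1 / (p - 1) := by have := sub_pos.2 hp; positivity
  refine lintegral_mono fun ρ => ?_
  gcongr

lemma wolffPot_smul {ν : Measure (EuclideanSpace ℝ (Fin n))} (hp : 1 < p) {c : ℝ≥0∞}
    (hc : c ≠ ∞) (x : EuclideanSpace ℝ (Fin n)) :
    wolffPot n α p (c • ν) x = c ^ (1 / (p - 1)) * wolffPot n α p ν x := by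
  have hs : 0 ≤ 1 / (p - 1) := by have := sub_pos.2 hp; positivity
  unfold wolffPot
  rw [← lintegral_const_mul' _ _ (ENNReal.rpow_ne_top_of_nonneg hs hc)]
  refine lintegral_congr fun ρ => ?_
  rw [Measure.smul_apply, smul_eq_mul, mul_div_assoc, ENNReal.mul_rpow_of_nonneg _ _ hs,
    mul_div_assoc]

lemma wolffPot_zero (hp : 1 < p) (x : EuclideanSpace ℝ (Fin n)) :
    wolffPot n α p (0 : Measure (EuclideanSpace ℝ (Fin n))) x = 0 := by
  have hs : 0 < (p - 1)⁻¹ := inv_pos.2 (sub_pos.2 hp)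
  simp [wolffPot, ENNReal.zero_rpow_of_pos hs]

lemma exists_measure_le_lintegral_wolffPot (hp : 1 < p) (hq0 : 0 < q) (hqp : q < p - 1)
    {E : Set (EuclideanSpace ℝ (Fin n))} {t : ℝ≥0∞}
    (ht : t < embC n α p q σ E ^ (q * (p - 1) / (p - 1 - q))) :
    ∃ ν : Measure (EuclideanSpace ℝ (Fin n)), ν univ ≤ t ∧
      t ≤ ∫⁻ y in E, wolffPot n α p ν y ^ q ∂σ := by
  have hp1 : 0 < p - 1 := by linarith
  have hpq : 0 < p - 1 - q := by linarith
  set γ := q * (p - 1) / (p - 1 - q) with hγ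
  have hγ0 : 0 < γ := by positivity
  rcases eq_or_ne t 0 with rfl | ht0
  · exact ⟨0, by simp, by simp⟩
  have htt : t ≠ ∞ := ht.ne_top
  set k := t ^ (1 / γ) with hk
  have hk1 : k < embC n α p q σ E := by
    rw [hk, one_div, ENNReal.rpow_inv_lt_iff hγ0]; exact ht
  have hk2 := notMem_of_lt_csInf' hk1
  simp only [mem_ofPred_eq, not_forall, not_le, exists_prop] at hk2
  obtain ⟨ν, hν, hlt⟩ := hk2
  set m := ν univ with hm
  have hmt : m ≠ ∞ := measure_ne_top ν _
  have hm0 : m ≠ 0 := by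
    intro h0
    rw [hm, Measure.measure_univ_eq_zero] at h0
    subst h0
    simp [wolffPot_zero hp, ENNReal.zero_rpow_of_pos hq0,
      ENNReal.zero_rpow_of_pos (inv_pos.2 hq0)] at hlt
  have htm : t / m ≠ ∞ := ENNReal.div_ne_top htt hm0
  refine ⟨(t / m) • ν, ?_, ?_⟩
  · rw [Measure.smul_apply, smul_eq_mul, ← hm, ENNReal.div_mul_cancel hm0 hmt]
  · simp_rw [wolffPot_smul hp htm, ENNReal.mul_rpow_of_nonneg _ _ hq0.le, ← ENNReal.rpow_mul]
    rw [lintegral_const_mul' _ _ (ENNReal.rpow_ne_top_of_nonneg (by positivity) htm)]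
    have h1 : (k * m ^ (1 / (p - 1))) ^ q ≤ ∫⁻ y in E, wolffPot n α p ν y ^ q ∂σ := by
      rw [← ENNReal.le_rpow_inv_iff hq0, ← one_div]
      exact hlt.le
    refine le_trans (le_of_eq ?_) (mul_le_mul_right h1 _)
    rw [ENNReal.mul_rpow_of_nonneg _ _ hq0.le, ← ENNReal.rpow_mul m, mul_left_comm,
      ← ENNReal.mul_rpow_of_nonneg _ _ (by positivity), ENNReal.div_mul_cancel hm0 hmt, hk,
      ← ENNReal.rpow_mul, ← ENNReal.rpow_add _ _ ht0 htt]
    conv_lhs => rw [← ENNReal.rpow_one t]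
    congr 1
    rw [hγ]
    field_simp
    ring

lemma embC_rpow_add_le (hp : 1 < p) (hq0 : 0 < q) (hqp : q < p - 1)
    {A B E : Set (EuclideanSpace ℝ (Fin n))} (hB : MeasurableSet B) (hAB : Disjoint A B)
    (hE : A ∪ B ⊆ E) {a b : ℝ≥0∞} {ν ν' : Measure (EuclideanSpace ℝ (Fin n))}
    (ha : a ≠ ∞) (hb : b ≠ ∞)
    (hν : ν univ ≤ a) (hνA : a ≤ ∫⁻ y in A, wolffPot n α p ν y ^ q ∂σ)
    (hν' : ν' univ ≤ b) (hνB : b ≤ ∫⁻ y in B, wolffPot n α p ν' y ^ q ∂σ) :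
    a + b ≤ embC n α p q σ E ^ (q * (p - 1) / (p - 1 - q)) := by
  have hp1 : 0 < p - 1 := by linarith
  have hpq : 0 < p - 1 - q := by linarith
  set γ := q * (p - 1) / (p - 1 - q) with hγ
  have hγ0 : 0 < γ := by positivity
  rcases eq_or_ne (a + b) 0 with h0 | h0
  · rw [h0]; exact zero_le
  have ht : a + b ≠ ∞ := ENNReal.add_ne_top.2 ⟨ha, hb⟩
  rw [← ENNReal.rpow_inv_le_iff hγ0]
  refine le_sInf fun κ hκ => ?_
  have hνle : (ν + ν') univ ≤ a + b := by
    rw [Measure.add_apply]; exact add_le_add hν hν'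
  have h1 := hκ (ν + ν') ⟨hνle.trans_lt ht.lt_top⟩
  have h2 : a + b ≤ ∫⁻ y in E, wolffPot n α p (ν + ν') y ^ q ∂σ := by
    calc a + b ≤ (∫⁻ y in A, wolffPot n α p (ν + ν') y ^ q ∂σ) +
          ∫⁻ y in B, wolffPot n α p (ν + ν') y ^ q ∂σ := by
          refine add_le_add (hνA.trans ?_) (hνB.trans ?_)
          · refine lintegral_mono fun y => ENNReal.rpow_le_rpow (wolffPot_mono hp ?_ y) hq0.le
            exact Measure.le_add_right le_rfl
          · refine lintegral_mono fun y => ENNReal.rpow_le_rpow (wolffPot_mono hp ?_ y) hq0.le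
            exact Measure.le_add_left le_rfl
      _ = ∫⁻ y in A ∪ B, wolffPot n α p (ν + ν') y ^ q ∂σ := (lintegral_union hB hAB).symm
      _ ≤ _ := lintegral_mono_set hE
  have h3 : (a + b) ^ (1 / q) ≤ κ * (a + b) ^ (1 / (p - 1)) :=
    (ENNReal.rpow_le_rpow h2 (by positivity)).trans
      (h1.trans (mul_le_mul_right (ENNReal.rpow_le_rpow hνle (by positivity)) _))
  have h4 : (a + b) ^ γ⁻¹ = (a + b) ^ (1 / q) / (a + b) ^ (1 / (p - 1)) := by
    rw [← ENNReal.rpow_sub _ _ h0 ht]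
    congr 1
    rw [hγ]
    field_simp
  rw [h4]
  exact ENNReal.div_le_of_le_mul h3

lemma embC_mono (hq0 : 0 < q) {A E : Set (EuclideanSpace ℝ (Fin n))} (h : A ⊆ E) :
    embC n α p q σ A ≤ embC n α p q σ E := by
  refine sInf_le_sInf fun κ hκ ν hν => le_trans ?_ (hκ ν hν)
  exact ENNReal.rpow_le_rpow (lintegral_mono_set h) (by positivity)

lemma ENNReal.add_le_of_forall_lt_of_ne_zero {a b c : ℝ≥0∞} (ha : a ≠ 0) (hb : b ≠ 0)
    (h : ∀ a' < a, ∀ b' < b, a' + b' ≤ c) : a + b ≤ c := by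
  have h1 : ∀ b' < b, a + b' ≤ c := fun b' hb' => by
    have h2 : a ≤ c - b' := le_of_forall_lt_imp_le_of_dense fun a' ha' =>
      ENNReal.le_sub_of_add_le_right hb'.ne_top (h a' ha' b' hb')
    have h3 : b' ≤ c := by simpa using h 0 (pos_iff_ne_zero.2 ha) b' hb'
    exact (add_le_add_left h2 b').trans (tsub_add_cancel_of_le h3).le
  rcases eq_or_ne a ∞ with rfl | hat
  · simpa using h1 0 (pos_iff_ne_zero.2 hb)
  have h2 : b ≤ c - a := le_of_forall_lt_imp_le_of_dense fun b' hb' =>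
    ENNReal.le_sub_of_add_le_left hat (h1 b' hb')
  have h3 : a ≤ c := by simpa using h1 0 (pos_iff_ne_zero.2 hb)
  exact (add_le_add_right h2 a).trans (add_tsub_cancel_of_le h3).le

lemma embC_rpow_add_embC_rpow_le (hp : 1 < p) (hq0 : 0 < q) (hqp : q < p - 1)
    {A B E : Set (EuclideanSpace ℝ (Fin n))} (hB : MeasurableSet B) (hAB : Disjoint A B)
    (hE : A ∪ B ⊆ E) :
    embC n α p q σ A ^ (q * (p - 1) / (p - 1 - q)) +
        embC n α p q σ B ^ (q * (p - 1) / (p - 1 - q)) ≤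
      embC n α p q σ E ^ (q * (p - 1) / (p - 1 - q)) := by
  have hp1 : 0 < p - 1 := by linarith
  have hpq : 0 < p - 1 - q := by linarith
  have hγ0 : 0 ≤ q * (p - 1) / (p - 1 - q) := by positivity
  rcases eq_or_ne (embC n α p q σ A ^ (q * (p - 1) / (p - 1 - q))) 0 with hA0 | hA0
  · rw [hA0, zero_add]
    exact ENNReal.rpow_le_rpow (embC_mono hq0 (subset_union_right.trans hE)) hγ0
  rcases eq_or_ne (embC n α p q σ B ^ (q * (p - 1) / (p - 1 - q))) 0 with hB0 | hB0
  · rw [hB0, add_zero]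
    exact ENNReal.rpow_le_rpow (embC_mono hq0 (subset_union_left.trans hE)) hγ0
  refine ENNReal.add_le_of_forall_lt_of_ne_zero hA0 hB0 fun a ha b hb => ?_
  obtain ⟨ν, h1, h2⟩ := exists_measure_le_lintegral_wolffPot hp hq0 hqp ha
  obtain ⟨ν', h3, h4⟩ := exists_measure_le_lintegral_wolffPot hp hq0 hqp hb
  exact embC_rpow_add_le hp hq0 hqp hB hAB hE ha.ne_top hb.ne_top h1 h2 h3 h4

/-- The set function `E ↦ κ(E)^{q(p−1)/(p−1−q)}` is countably superadditive. -/
lemma tsum_embC_rpow_le (hp : 1 < p) (hq0 : 0 < q) (hqp : q < p - 1) {ι : Type*}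
    {A : ι → Set (EuclideanSpace ℝ (Fin n))} {E : Set (EuclideanSpace ℝ (Fin n))}
    (hA : ∀ i, MeasurableSet (A i)) (hd : Pairwise (Function.onFun Disjoint A))
    (hE : ∀ i, A i ⊆ E) :
    ∑' i, embC n α p q σ (A i) ^ (q * (p - 1) / (p - 1 - q)) ≤
      embC n α p q σ E ^ (q * (p - 1) / (p - 1 - q)) := by
  classical
  have hp1 : 0 < p - 1 := by linarith
  have hpq : 0 < p - 1 - q := by linarith
  have hγ0 : 0 ≤ q * (p - 1) / (p - 1 - q) := by positivity
  have key : ∀ s : Finset ι, ∑ i ∈ s, embC n α p q σ (A i) ^ (q * (p - 1) / (p - 1 - q)) ≤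
      embC n α p q σ (⋃ i ∈ s, A i) ^ (q * (p - 1) / (p - 1 - q)) := by
    intro s
    induction s using Finset.induction_on with
    | empty => simp
    | insert i s hi ih =>
      rw [Finset.sum_insert hi]
      refine (add_le_add_right ih _).trans
        (embC_rpow_add_embC_rpow_le hp hq0 hqp (s.measurableSet_biUnion fun j _ => hA j) ?_ ?_)
      · rw [disjoint_iUnion₂_right]
        exact fun j hj => hd (by rintro rfl; exact hi hj)
      · rw [Finset.set_biUnion_insert]
  rw [ENNReal.tsum_eq_iSup_sum]
  exact iSup_le fun s => (key s).trans
    (ENNReal.rpow_le_rpow (embC_mono hq0 (iUnion₂_subset fun i _ => hE i)) hγ0)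

end Superadditivity

section Cubes

/-- The index of the dyadic cube of side length `2^{-k}` containing `x`. -/
noncomputable def dyadicIdx (n : ℕ) (k : ℤ) (x : EuclideanSpace ℝ (Fin n)) : Fin n → ℤ :=
  fun i => ⌊x i * (2 : ℝ) ^ k⌋

/-- The index of the `m`-th dyadic ancestor of a cube with index `M`. -/
def dyadicAncestor {n : ℕ} (m : ℕ) (M : Fin n → ℤ) : Fin n → ℤ :=
  fun i => M i / ((2 ^ m : ℕ) : ℤ)

variable {n : ℕ}

lemma mem_dyadicCube_iff {k : ℤ} {M : Fin n → ℤ} {x : EuclideanSpace ℝ (Fin n)} :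
    x ∈ dyadicCube n k M ↔ dyadicIdx n k x = M := by
  have h2 : (0 : ℝ) < 2 ^ k := by positivity
  simp only [dyadicCube, mem_ofPred_eq, dyadicIdx, funext_iff, Int.floor_eq_iff, zpow_neg,
    ← div_eq_mul_inv, div_le_iff₀ h2, lt_div_iff₀ h2]

lemma preimage_dyadicIdx_singleton (k : ℤ) (M : Fin n → ℤ) :
    dyadicIdx n k ⁻¹' {M} = dyadicCube n k M := by
  ext x
  simp [mem_dyadicCube_iff]

lemma dyadicAncestor_dyadicIdx (k : ℤ) (m : ℕ) (x : EuclideanSpace ℝ (Fin n)) :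
    dyadicAncestor m (dyadicIdx n (k + m) x) = dyadicIdx n k x := by
  funext i
  simp only [dyadicAncestor, dyadicIdx]
  rw [← Int.floor_div_natCast]
  congr 1
  rw [zpow_add₀ two_ne_zero]
  push_cast
  rw [zpow_natCast]
  field_simp

lemma measurable_dyadicIdx (k : ℤ) : Measurable (dyadicIdx n k) := by
  refine measurable_pi_lambda _ fun i => Int.measurable_floor.comp ?_
  fun_prop

lemma measurableSet_dyadicCube (k : ℤ) (M : Fin n → ℤ) : MeasurableSet (dyadicCube n k M) := by
  rw [← preimage_dyadicIdx_singleton]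
  exact measurable_dyadicIdx k (measurableSet_singleton M)

lemma dyadicCube_subset_dyadicCube_ancestor (k : ℤ) (m : ℕ) (M : Fin n → ℤ) :
    dyadicCube n (k + m) M ⊆ dyadicCube n k (dyadicAncestor m M) := by
  intro x hx
  rw [mem_dyadicCube_iff] at hx ⊢
  rw [← hx, dyadicAncestor_dyadicIdx]

lemma disjoint_dyadicCube {k : ℤ} {M M' : Fin n → ℤ} (h : M ≠ M') :
    Disjoint (dyadicCube n k M) (dyadicCube n k M') := by
  rw [Set.disjoint_left]
  intro x hx hx'
  rw [mem_dyadicCube_iff] at hx hx'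
  exact h (hx.symm.trans hx')

lemma volume_dyadicCube (k : ℤ) (M : Fin n → ℤ) :
    volume (dyadicCube n k M) = (2 : ℝ≥0∞) ^ (-((k : ℝ) * n)) := by
  have h : dyadicCube n k M = (WithLp.ofLp : EuclideanSpace ℝ (Fin n) → Fin n → ℝ) ⁻¹'
      (Set.univ.pi fun i => Set.Ico ((M i : ℝ) * (2 : ℝ) ^ (-k))
        (((M i : ℝ) + 1) * (2 : ℝ) ^ (-k))) := by
    ext x
    simp [dyadicCube, Set.mem_pi]
  rw [h, (PiLp.volume_preserving_ofLp (Fin n)).measure_preimage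
    (MeasurableSet.univ_pi fun i => measurableSet_Ico).nullMeasurableSet, volume_pi_pi]
  simp only [Real.volume_Ico]
  have h2 : ∀ i, ((M i : ℝ) + 1) * (2 : ℝ) ^ (-k) - (M i : ℝ) * (2 : ℝ) ^ (-k) =
      (2 : ℝ) ^ (-(k : ℝ)) := by
    intro i
    rw [← Int.cast_neg, Real.rpow_intCast]
    ring
  simp only [h2, Finset.prod_const, Finset.card_univ, Fintype.card_fin]
  rw [← ENNReal.ofReal_rpow_of_pos two_pos, ENNReal.ofReal_ofNat, ← ENNReal.rpow_natCast,
    ← ENNReal.rpow_mul, neg_mul]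

lemma volume_preimage_dyadicIdx (k : ℤ) (T : Set (Fin n → ℤ)) :
    volume (dyadicIdx n k ⁻¹' T) =
      ∑' M, T.indicator (fun _ => (2 : ℝ≥0∞) ^ (-((k : ℝ) * n))) M := by
  rw [← tsum_measure_preimage_singleton (to_countable T)
    fun M _ => measurable_dyadicIdx k (measurableSet_singleton M), ← tsum_subtype]
  simp_rw [preimage_dyadicIdx_singleton, volume_dyadicCube]

end Cubes

section Counting

lemma exists_tsum_zpow_rpow_le {e : ℝ} (he : 0 < e) : ∃ D : ℝ≥0∞, D ≠ ∞ ∧ 1 ≤ D ∧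
    ∀ N : ℝ≥0∞, ∑' j : ℤ, (if (2 : ℝ≥0∞) ^ j ≤ N then ((2 : ℝ≥0∞) ^ j) ^ e else 0) ≤
      D * N ^ e := by
  set x : ℝ≥0∞ := 2 ^ (-e) with hx
  have hx1 : x < 1 := by
    rw [hx, ENNReal.rpow_neg, ENNReal.inv_lt_one]
    exact ENNReal.one_lt_rpow (by norm_num) he
  have hS : ∑' i : ℕ, x ^ i ≠ ∞ := by
    rw [ENNReal.tsum_geometric]
    exact ENNReal.inv_ne_top.2 (tsub_pos_of_lt hx1).ne'
  have h1S : 1 ≤ ∑' i : ℕ, x ^ i :=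
    (pow_zero x).ge.trans (ENNReal.le_tsum (f := fun i : ℕ => x ^ i) 0)
  refine ⟨∑' i : ℕ, x ^ i, hS, h1S, fun N => ?_⟩
  rcases eq_or_ne N ∞ with rfl | hN
  · rw [ENNReal.top_rpow_of_pos he, ENNReal.mul_top (one_pos.trans_le h1S).ne']
    exact le_top
  rcases eq_or_ne N 0 with rfl | hN0
  · have h2 : ∀ j : ℤ, ¬ (2 : ℝ≥0∞) ^ j ≤ 0 := fun j =>
      not_le.2 (ENNReal.zpow_pos two_ne_zero (by norm_num) j)
    simp [h2]
  obtain ⟨J, hJ1, hJ2⟩ := ENNReal.exists_mem_Ico_zpow hN0 hN (by norm_num : (1 : ℝ≥0∞) < 2)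
    (by norm_num)
  have hinj : Function.Injective fun i : ℕ => J - (i : ℤ) := fun i j h => by
    simpa using h
  have hsupp : Function.support
      (fun j : ℤ => if (2 : ℝ≥0∞) ^ j ≤ N then ((2 : ℝ≥0∞) ^ j) ^ e else 0) ⊆
      range fun i : ℕ => J - (i : ℤ) := by
    intro j hj
    have hjN : (2 : ℝ≥0∞) ^ j ≤ N := by
      by_contra hc
      simp [hc] at hj
    have : j < J + 1 := by
      by_contra hc
      have := ENNReal.zpow_le_of_le (by norm_num : (1 : ℝ≥0∞) ≤ 2) (not_lt.1 hc)
      exact absurd (this.trans hjN) (not_le.2 hJ2)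
    exact ⟨(J - j).toNat, by simp; omega⟩
  rw [← hinj.tsum_eq hsupp, ← ENNReal.tsum_mul_right]
  refine ENNReal.tsum_le_tsum fun i => ?_
  have h3 : ((2 : ℝ≥0∞) ^ (J - (i : ℤ))) ^ e = x ^ i * ((2 : ℝ≥0∞) ^ J) ^ e := by
    rw [hx, ← ENNReal.rpow_intCast, ← ENNReal.rpow_intCast, ← ENNReal.rpow_natCast,
      ← ENNReal.rpow_mul, ← ENNReal.rpow_mul, ← ENNReal.rpow_mul,
      ← ENNReal.rpow_add _ _ two_ne_zero (by norm_num)]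
    congr 1
    push_cast
    ring
  split_ifs
  · rw [h3]
    gcongr
  · exact zero_le

/-- Pointwise control of a sum over levels by its supremum and the numbers of terms in each
dyadic range. -/
lemma exists_tsum_rpow_le {r : ℝ} (hr : 0 < r) : ∃ C : ℝ≥0∞, C ≠ ∞ ∧ 1 ≤ C ∧
    ∀ b : ℤ → ℝ≥0∞, (∑' k, b k) ^ r ≤ C * ((⨆ k, b k) ^ r +
      ∑' j : ℤ, ((2 : ℝ≥0∞) ^ j) ^ r *
        (∑' k, if (2 : ℝ≥0∞) ^ j ≤ b k ∧ b k < 2 ^ (j + 1) then (1 : ℝ≥0∞) else 0) ^ (2 * r)) := by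
  obtain ⟨D, hD, hD1, hDN⟩ := exists_tsum_zpow_rpow_le (e := 1 / 2) (by norm_num)
  have h2D : 1 ≤ 2 * D := hD1.trans (le_mul_of_one_le_left zero_le (by norm_num))
  have hC1 : 1 ≤ (2 * D) ^ r := ENNReal.one_le_rpow h2D hr
  refine ⟨(2 * D) ^ r, ENNReal.rpow_ne_top_of_nonneg hr.le (ENNReal.mul_ne_top (by norm_num) hD),
    hC1, fun b => ?_⟩
  set N := ⨆ k, b k with hN
  set cnt : ℤ → ℝ≥0∞ := fun j =>
    ∑' k, if (2 : ℝ≥0∞) ^ j ≤ b k ∧ b k < 2 ^ (j + 1) then (1 : ℝ≥0∞) else 0 with hcnt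
  set B := ∑' j : ℤ, ((2 : ℝ≥0∞) ^ j) ^ r * cnt j ^ (2 * r) with hB
  change _ ≤ (2 * D) ^ r * (N ^ r + B)
  rcases eq_or_ne N ∞ with hNt | hNt
  · rw [hNt, ENNReal.top_rpow_of_pos hr, top_add, ENNReal.mul_top (one_pos.trans_le hC1).ne']
    exact le_top
  have hbt : ∀ k, b k ≠ ∞ := fun k => ((le_iSup b k).trans_lt hNt.lt_top).ne
  have hterm : ∀ k, b k ≤ ∑' j : ℤ, 2 ^ (j + 1) *
      (if (2 : ℝ≥0∞) ^ j ≤ b k ∧ b k < 2 ^ (j + 1) then (1 : ℝ≥0∞) else 0) := by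
    intro k
    rcases eq_or_ne (b k) 0 with h0 | h0
    · rw [h0]; exact zero_le
    obtain ⟨j, hj1, hj2⟩ := ENNReal.exists_mem_Ico_zpow h0 (hbt k) (by norm_num : (1 : ℝ≥0∞) < 2)
      (by norm_num)
    refine le_trans ?_ (ENNReal.le_tsum j)
    rw [if_pos ⟨hj1, hj2⟩, mul_one]
    exact hj2.le
  have hcntB : ∀ j : ℤ, ((2 : ℝ≥0∞) ^ j) ^ (1 / 2 : ℝ) * cnt j ≤ B ^ (1 / (2 * r)) := by
    intro j
    rw [one_div (2 * r), ENNReal.le_rpow_inv_iff (by positivity)]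
    refine le_trans (le_of_eq ?_) (ENNReal.le_tsum j)
    rw [ENNReal.mul_rpow_of_nonneg _ _ (by positivity), ← ENNReal.rpow_mul]
    congr 2
    ring
  have hsplit : ∀ j : ℤ, 2 ^ (j + 1) * cnt j ≤
      2 * (if (2 : ℝ≥0∞) ^ j ≤ N then ((2 : ℝ≥0∞) ^ j) ^ (1 / 2 : ℝ) else 0) *
        B ^ (1 / (2 * r)) := by
    intro j
    split_ifs with h
    · rw [ENNReal.zpow_add two_ne_zero (by norm_num), zpow_one, mul_comm (2 ^ j) (2 : ℝ≥0∞)]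
      have h2 : (2 : ℝ≥0∞) ^ j = (2 ^ j) ^ (1 / 2 : ℝ) * (2 ^ j) ^ (1 / 2 : ℝ) := by
        rw [← ENNReal.rpow_add_of_nonneg _ _ (by norm_num) (by norm_num)]
        norm_num
      calc 2 * (2 : ℝ≥0∞) ^ j * cnt j
          = 2 * (2 ^ j) ^ (1 / 2 : ℝ) * ((2 ^ j) ^ (1 / 2 : ℝ) * cnt j) := by
            conv_lhs => rw [h2]
            ring
        _ ≤ _ := by gcongr; exact hcntB j
    · have : cnt j = 0 := by
        rw [hcnt, ENNReal.tsum_eq_zero]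
        intro k
        rw [if_neg]
        exact fun hk => h (hk.1.trans (le_iSup b k))
      simp [this]
  have hsum : ∑' k, b k ≤ 2 * D * (N ^ (1 / 2 : ℝ) * B ^ (1 / (2 * r))) := by
    calc ∑' k, b k ≤ ∑' k, ∑' j : ℤ, 2 ^ (j + 1) *
          (if (2 : ℝ≥0∞) ^ j ≤ b k ∧ b k < 2 ^ (j + 1) then (1 : ℝ≥0∞) else 0) :=
          ENNReal.tsum_le_tsum hterm
      _ = ∑' j : ℤ, 2 ^ (j + 1) * cnt j := by
          rw [ENNReal.tsum_comm]
          simp_rw [ENNReal.tsum_mul_left]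
          rfl
      _ ≤ ∑' j : ℤ, 2 * (if (2 : ℝ≥0∞) ^ j ≤ N then ((2 : ℝ≥0∞) ^ j) ^ (1 / 2 : ℝ) else 0) *
            B ^ (1 / (2 * r)) := ENNReal.tsum_le_tsum hsplit
      _ ≤ 2 * (D * N ^ (1 / 2 : ℝ)) * B ^ (1 / (2 * r)) := by
          rw [ENNReal.tsum_mul_right, ENNReal.tsum_mul_left]
          gcongr
          exact hDN N
      _ = _ := by ring
  refine (ENNReal.rpow_le_rpow hsum hr.le).trans ?_
  rw [ENNReal.mul_rpow_of_nonneg _ _ hr.le]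
  gcongr
  have hmax : N ^ (1 / 2 : ℝ) * B ^ (1 / (2 * r)) ≤ (max (N ^ r) B) ^ (1 / r) := by
    have h1 : N ^ (1 / 2 : ℝ) ≤ (max (N ^ r) B) ^ (1 / (2 * r)) := by
      refine le_trans (le_of_eq ?_) (ENNReal.rpow_le_rpow (le_max_left _ _) (by positivity))
      rw [← ENNReal.rpow_mul]
      congr 1
      field_simp
    have h2 : B ^ (1 / (2 * r)) ≤ (max (N ^ r) B) ^ (1 / (2 * r)) :=
      ENNReal.rpow_le_rpow (le_max_right _ _) (by positivity)
    refine (mul_le_mul' h1 h2).trans (le_of_eq ?_)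
    rw [← ENNReal.rpow_add_of_nonneg _ _ (by positivity) (by positivity)]
    congr 1
    field_simp
    norm_num
  refine (ENNReal.rpow_le_rpow hmax hr.le).trans ?_
  rw [← ENNReal.rpow_mul, one_div_mul_cancel hr.ne', ENNReal.rpow_one]
  exact max_le (le_add_of_nonneg_right zero_le) (le_add_of_nonneg_left zero_le)

/-- If a set of levels is bounded below by `k₀`, powers of its cardinality are controlled by a
weighted sum over its elements. -/
lemma tsum_indicator_rpow_le (S : Set ℤ) [DecidablePred (· ∈ S)] {k₀ : ℤ} (h : ∀ k ∈ S, k₀ ≤ k)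
    {A : ℝ} (hA : 0 < A) :
    (∑' k, if k ∈ S then (1 : ℝ≥0∞) else 0) ^ A ≤
      ∑' m : ℕ, if k₀ + m ∈ S then ((m : ℝ≥0∞) + 1) ^ A else 0 := by
  rw [← ENNReal.le_rpow_inv_iff hA, ENNReal.tsum_eq_iSup_sum]
  refine iSup_le fun s => ?_
  rw [Finset.sum_boole]
  rcases (s.filter (· ∈ S)).eq_empty_or_nonempty with he | hne
  · simp [he]
  have hmem := (s.filter (· ∈ S)).max'_mem hne
  set k₁ := (s.filter (· ∈ S)).max' hne with hk₁
  have hk₁S : k₁ ∈ S := (Finset.mem_filter.1 hmem).2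
  obtain ⟨m, hm⟩ := Int.eq_ofNat_of_zero_le (sub_nonneg.2 (h k₁ hk₁S))
  have hsub : s.filter (· ∈ S) ⊆ Finset.Icc k₀ k₁ := fun k hk =>
    Finset.mem_Icc.2 ⟨h k (Finset.mem_filter.1 hk).2, Finset.le_max' _ k hk⟩
  have hcard : (s.filter (· ∈ S)).card ≤ m + 1 := by
    refine (Finset.card_le_card hsub).trans ?_
    rw [Int.card_Icc]
    omega
  have hcard' : ((s.filter (· ∈ S)).card : ℝ≥0∞) ≤ (m : ℝ≥0∞) + 1 := by exact_mod_cast hcard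
  refine hcard'.trans ?_
  rw [ENNReal.le_rpow_inv_iff hA]
  refine le_trans ?_ (ENNReal.le_tsum m)
  rw [if_pos (by rwa [show k₀ + (m : ℤ) = k₁ by omega])]

end Counting

section Decay

variable {n : ℕ} {θ : ℝ} {lam : ℤ → (Fin n → ℤ) → ℝ≥0∞}

lemma volume_descendants_le
    (hlam : ∀ (k : ℤ) (m : ℕ) (M : Fin n → ℤ),
      ∑' M' : (dyadicAncestor (n := n) m) ⁻¹' {M}, lam (k + m) M' ≤ lam k M)
    {u w : ℝ≥0∞} (hw0 : w ≠ 0) (hwt : w ≠ ∞) (k : ℤ) (m : ℕ) {F : Set (Fin n → ℤ)}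
    (hF : ∀ M ∈ F, lam k M ≤ u * ((2 : ℝ≥0∞) ^ (-((k : ℝ) * n))) ^ θ) :
    volume {x : EuclideanSpace ℝ (Fin n) | dyadicIdx n k x ∈ F ∧
        w * ((2 : ℝ≥0∞) ^ (-(((k + m : ℤ) : ℝ) * n))) ^ θ ≤ lam (k + m) (dyadicIdx n (k + m) x)} ≤
      u / w * (2 : ℝ≥0∞) ^ (-((m : ℝ) * (n * (1 - θ)))) * volume (dyadicIdx n k ⁻¹' F) := by
  classical
  set V : ℤ → ℝ≥0∞ := fun k => (2 : ℝ≥0∞) ^ (-((k : ℝ) * n)) with hV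
  have hV0 : ∀ k, V k ≠ 0 := fun k => (ENNReal.rpow_pos (by norm_num) (by norm_num)).ne'
  have hVt : ∀ k, V k ≠ ∞ := fun k => by simp [hV]
  set T : Set (Fin n → ℤ) :=
    {M' | dyadicAncestor m M' ∈ F ∧ w * V (k + m) ^ θ ≤ lam (k + m) M'} with hT
  have hset : {x : EuclideanSpace ℝ (Fin n) | dyadicIdx n k x ∈ F ∧
      w * V (k + m) ^ θ ≤ lam (k + m) (dyadicIdx n (k + m) x)} = dyadicIdx n (k + m) ⁻¹' T := by
    ext x
    simp only [mem_ofPred_eq, hT, mem_preimage, dyadicAncestor_dyadicIdx]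
  change volume {x : EuclideanSpace ℝ (Fin n) | dyadicIdx n k x ∈ F ∧
      w * V (k + m) ^ θ ≤ lam (k + m) (dyadicIdx n (k + m) x)} ≤ _
  rw [hset, volume_preimage_dyadicIdx, volume_preimage_dyadicIdx]
  change ∑' M', T.indicator (fun _ => V (k + m)) M' ≤ _ * ∑' M, F.indicator (fun _ => V k) M
  set c : ℝ≥0∞ := V (k + m) ^ (1 - θ) / w with hc
  have hterm : ∀ M', T.indicator (fun _ => V (k + m)) M' ≤
      if dyadicAncestor m M' ∈ F then c * lam (k + m) M' else 0 := by
    intro M'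
    by_cases hM : M' ∈ T
    · rw [indicator_of_mem hM, if_pos hM.1]
      calc V (k + m) = V (k + m) ^ (1 - θ) / w * (w * V (k + m) ^ θ) := by
            rw [← mul_assoc, ENNReal.div_mul_cancel hw0 hwt,
              ← ENNReal.rpow_add _ _ (hV0 _) (hVt _)]
            simp
        _ ≤ _ := by gcongr; exact hM.2
    · rw [indicator_of_notMem hM]
      exact zero_le
  have hconst : c * (u * V k ^ θ) = u / w * (2 : ℝ≥0∞) ^ (-((m : ℝ) * (n * (1 - θ)))) * V k := by
    have h1 : V (k + m) ^ (1 - θ) * V k ^ θ =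
        (2 : ℝ≥0∞) ^ (-((m : ℝ) * (n * (1 - θ)))) * V k := by
      simp only [hV]
      rw [← ENNReal.rpow_mul, ← ENNReal.rpow_mul, ← ENNReal.rpow_add _ _ two_ne_zero (by norm_num),
        ← ENNReal.rpow_add _ _ two_ne_zero (by norm_num)]
      congr 1
      push_cast
      ring
    rw [hc, mul_assoc (u / w), ← h1, div_eq_mul_inv, div_eq_mul_inv]
    ring
  calc ∑' M', T.indicator (fun _ => V (k + m)) M'
      ≤ ∑' M', if dyadicAncestor m M' ∈ F then c * lam (k + m) M' else 0 :=
        ENNReal.tsum_le_tsum hterm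
    _ = ∑' M, ∑' M' : (dyadicAncestor (n := n) m) ⁻¹' {M},
          if dyadicAncestor m (M' : Fin n → ℤ) ∈ F then c * lam (k + m) M' else 0 :=
        (ENNReal.tsum_fiberwise _ (dyadicAncestor m)).symm
    _ ≤ ∑' M, u / w * (2 : ℝ≥0∞) ^ (-((m : ℝ) * (n * (1 - θ)))) *
          F.indicator (fun _ => V k) M := by
        refine ENNReal.tsum_le_tsum fun M => ?_
        by_cases hM : M ∈ F
        · rw [indicator_of_mem hM, ← hconst]
          calc ∑' M' : (dyadicAncestor (n := n) m) ⁻¹' {M},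
                (if dyadicAncestor m (M' : Fin n → ℤ) ∈ F then c * lam (k + m) M' else 0)
              ≤ ∑' M' : (dyadicAncestor (n := n) m) ⁻¹' {M}, c * lam (k + m) M' := by
                refine ENNReal.tsum_le_tsum fun M' => ?_
                split_ifs
                · exact le_rfl
                · exact zero_le
            _ ≤ c * (u * V k ^ θ) := by
                rw [ENNReal.tsum_mul_left]
                gcongr
                exact (hlam k m M).trans (hF M hM)
        · rw [indicator_of_notMem hM, mul_zero, nonpos_iff_eq_zero, ENNReal.tsum_eq_zero]
          intro M'
          have : dyadicAncestor m (M' : Fin n → ℤ) = M := M'.2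
          rw [this, if_neg hM]
    _ = _ := ENNReal.tsum_mul_left

lemma tsum_add_one_rpow_mul_two_rpow_ne_top {A δ : ℝ} (hδ : 0 < δ) :
    ∑' m : ℕ, ((m : ℝ≥0∞) + 1) ^ A * (2 : ℝ≥0∞) ^ (-((m : ℝ) * δ)) ≠ ∞ := by
  obtain ⟨N, hN⟩ := exists_nat_ge A
  have hx : ‖(2 : ℝ) ^ (-δ)‖ < 1 := by
    rw [Real.norm_of_nonneg (by positivity)]
    exact Real.rpow_lt_one_of_one_lt_of_neg (by norm_num) (by linarith)
  have hs := summable_pow_mul_geometric_of_norm_lt_one N hx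
  have hx0 : (2 : ℝ) ^ (-δ) ≠ 0 := by positivity
  have hs1 : Summable fun m : ℕ => ((m : ℝ) + 1) ^ N * ((2 : ℝ) ^ (-δ)) ^ m := by
    have := ((summable_nat_add_iff 1).2 hs).mul_right ((2 : ℝ) ^ (-δ))⁻¹
    refine this.congr fun m => ?_
    push_cast
    rw [pow_succ]
    field_simp
  refine ne_top_of_le_ne_top hs1.tsum_ofReal_ne_top (ENNReal.tsum_le_tsum fun m => ?_)
  rw [ENNReal.ofReal_mul (by positivity)]
  gcongr
  · rw [ENNReal.ofReal_pow (by positivity), ENNReal.ofReal_add (by positivity) (by norm_num),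
      ENNReal.ofReal_natCast, ENNReal.ofReal_one, ← ENNReal.rpow_natCast]
    exact ENNReal.rpow_le_rpow_of_exponent_le (by simp) hN
  · rw [ENNReal.ofReal_pow (by positivity), ← ENNReal.ofReal_rpow_of_pos two_pos,
      ENNReal.ofReal_ofNat, ← ENNReal.rpow_natCast, ← ENNReal.rpow_mul]
    refine le_of_eq ?_
    congr 1
    ring

lemma exists_lower_bound_of_volume_ne_top (hn : 1 ≤ n) {S : ℤ → Set (Fin n → ℤ)}
    (hS : volume {x : EuclideanSpace ℝ (Fin n) | ∃ k, dyadicIdx n k x ∈ S k} ≠ ∞) :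
    ∃ K : ℤ, ∀ k x, dyadicIdx n k x ∈ S k → K ≤ k := by
  obtain ⟨N, hN⟩ := ENNReal.exists_nat_gt hS
  refine ⟨-N, fun k x hx => ?_⟩
  by_contra! hk
  have hsub : dyadicCube n k (dyadicIdx n k x) ⊆
      {x : EuclideanSpace ℝ (Fin n) | ∃ k, dyadicIdx n k x ∈ S k} := by
    intro y hy
    rw [mem_dyadicCube_iff] at hy
    exact ⟨k, hy ▸ hx⟩
  have h1 := measure_mono (μ := volume) hsub
  rw [volume_dyadicCube] at h1
  refine absurd (h1.trans_lt hN) (not_lt.2 ?_)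
  have hkN : (N : ℝ) ≤ -k := by
    have : (N : ℤ) ≤ -k := by omega
    exact_mod_cast this
  have hn' : (1 : ℝ) ≤ n := by exact_mod_cast hn
  calc (N : ℝ≥0∞) ≤ ((2 ^ N : ℕ) : ℝ≥0∞) := by exact_mod_cast Nat.lt_two_pow_self.le
    _ = (2 : ℝ≥0∞) ^ (N : ℝ) := by rw [ENNReal.rpow_natCast]; norm_cast
    _ ≤ _ := by
        refine ENNReal.rpow_le_rpow_of_exponent_le (by norm_num) ?_
        nlinarith [(Nat.cast_nonneg N : (0 : ℝ) ≤ N)]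

/-- Moments of the number of dyadic cubes `Q ∋ x` with `w ≤ λ(Q) / |Q|^θ ≤ u`, for a superadditive
cube function `λ`. -/
lemma lintegral_count_rpow_le (hn : 1 ≤ n)
    (hlam : ∀ (k : ℤ) (m : ℕ) (M : Fin n → ℤ),
      ∑' M' : (dyadicAncestor (n := n) m) ⁻¹' {M}, lam (k + m) M' ≤ lam k M)
    {u w : ℝ≥0∞} (hw0 : w ≠ 0) (hwt : w ≠ ∞) (hwu : w ≤ u) {A : ℝ} (hA : 0 < A)
    (S : ℤ → Set (Fin n → ℤ)) [∀ k, DecidablePred (· ∈ S k)]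
    (hSw : ∀ k, ∀ M ∈ S k, w * ((2 : ℝ≥0∞) ^ (-((k : ℝ) * n))) ^ θ ≤ lam k M)
    (hSu : ∀ k, ∀ M ∈ S k, lam k M ≤ u * ((2 : ℝ≥0∞) ^ (-((k : ℝ) * n))) ^ θ) :
    ∫⁻ x : EuclideanSpace ℝ (Fin n),
        (∑' k, if dyadicIdx n k x ∈ S k then (1 : ℝ≥0∞) else 0) ^ A ≤
      u / w * (∑' m : ℕ, ((m : ℝ≥0∞) + 1) ^ A * (2 : ℝ≥0∞) ^ (-((m : ℝ) * (n * (1 - θ))))) *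
        volume {x : EuclideanSpace ℝ (Fin n) | ∃ k, dyadicIdx n k x ∈ S k} := by
  classical
  set U := {x : EuclideanSpace ℝ (Fin n) | ∃ k, dyadicIdx n k x ∈ S k} with hU
  set D := ∑' m : ℕ, ((m : ℝ≥0∞) + 1) ^ A * (2 : ℝ≥0∞) ^ (-((m : ℝ) * (n * (1 - θ)))) with hD
  by_cases hUt : volume U = ∞
  · have hD0 : D ≠ 0 := by
      intro h0
      have := ENNReal.tsum_eq_zero.1 h0 0
      simp at this
    rw [hUt, ENNReal.mul_top (mul_ne_zero (ENNReal.div_ne_zero.2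
      ⟨(pos_iff_ne_zero.2 hw0 |>.trans_le hwu).ne', hwt⟩) hD0)]
    exact le_top
  obtain ⟨K, hK⟩ := exists_lower_bound_of_volume_ne_top hn hUt
  set F : ℤ → Set (Fin n → ℤ) := fun k =>
    {M | M ∈ S k ∧ ∀ j : ℕ, 0 < j → dyadicAncestor j M ∉ S (k - j)} with hF
  have hFx : ∀ k x, dyadicIdx n k x ∈ F k ↔
      dyadicIdx n k x ∈ S k ∧ ∀ k' < k, dyadicIdx n k' x ∉ S k' := by
    intro k x
    simp only [hF, mem_ofPred_eq]
    refine and_congr_right fun _ => ⟨fun h k' hk' => ?_, fun h j hj => ?_⟩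
    · obtain ⟨j, hj⟩ := Int.eq_ofNat_of_zero_le (sub_nonneg.2 hk'.le)
      have h1 := h j (by omega)
      have h2 : k = (k - j) + j := by ring
      have h3 : dyadicAncestor j (dyadicIdx n k x) = dyadicIdx n (k - j) x := by
        conv_lhs => rw [h2]
        exact dyadicAncestor_dyadicIdx _ _ _
      rw [h3] at h1
      rwa [show k' = k - j by omega]
    · have h2 : k = (k - j) + j := by ring
      have h3 : dyadicAncestor j (dyadicIdx n k x) = dyadicIdx n (k - j) x := by
        conv_lhs => rw [h2]
        exact dyadicAncestor_dyadicIdx _ _ _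
      rw [h3]
      exact h _ (by omega)
  set E : ℤ → ℕ → Set (EuclideanSpace ℝ (Fin n)) := fun k m =>
    {x | dyadicIdx n k x ∈ F k ∧ dyadicIdx n (k + m) x ∈ S (k + m)} with hE
  have hEm : ∀ k m, MeasurableSet (E k m) := fun k m =>
    (measurable_dyadicIdx k (MeasurableSet.of_discrete (s := F k))).inter
      (measurable_dyadicIdx (k + m) (MeasurableSet.of_discrete (s := S (k + m))))
  have hpt : ∀ x : EuclideanSpace ℝ (Fin n),
      (∑' k, if dyadicIdx n k x ∈ S k then (1 : ℝ≥0∞) else 0) ^ A ≤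
        ∑' k, ∑' m : ℕ, (E k m).indicator (fun _ => ((m : ℝ≥0∞) + 1) ^ A) x := by
    intro x
    by_cases hx : x ∈ U
    · obtain ⟨k₀, hk₀, hmin⟩ := Int.exists_least_of_bdd
        (P := fun k => dyadicIdx n k x ∈ S k) ⟨K, fun k hk => hK k x hk⟩ hx
      have hk₀F : dyadicIdx n k₀ x ∈ F k₀ :=
        (hFx k₀ x).2 ⟨hk₀, fun k' hk' hS => absurd (hmin k' hS) (not_le.2 hk')⟩
      refine (tsum_indicator_rpow_le {k | dyadicIdx n k x ∈ S k} hmin hA).trans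
        (le_trans ?_ (ENNReal.le_tsum k₀))
      refine ENNReal.tsum_le_tsum fun m => ?_
      by_cases hm : dyadicIdx n (k₀ + m) x ∈ S (k₀ + m)
      · rw [indicator_of_mem (show x ∈ E k₀ m from ⟨hk₀F, hm⟩)]
        split_ifs
        · exact le_rfl
        · exact zero_le
      · rw [if_neg (show k₀ + (m : ℤ) ∉ {k | dyadicIdx n k x ∈ S k} from hm)]
        exact zero_le
    · have : ∀ k, dyadicIdx n k x ∉ S k := fun k hk => hx ⟨k, hk⟩
      simp [this, ENNReal.zero_rpow_of_pos hA]
  have hEle : ∀ k m, volume (E k m) ≤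
      u / w * (2 : ℝ≥0∞) ^ (-((m : ℝ) * (n * (1 - θ)))) * volume (dyadicIdx n k ⁻¹' F k) := by
    intro k m
    refine le_trans (measure_mono ?_)
      (volume_descendants_le hlam hw0 hwt k m fun M hM => hSu k M hM.1)
    exact fun x hx => ⟨hx.1, hSw _ _ hx.2⟩
  have hdisj : Pairwise (Function.onFun Disjoint fun k => dyadicIdx n k ⁻¹' F k) := by
    intro k k' hkk'
    rw [Function.onFun, Set.disjoint_left]
    intro x hx hx'
    rw [mem_preimage, hFx] at hx hx'
    rcases lt_or_gt_of_ne hkk' with h | h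
    · exact hx'.2 k h hx.1
    · exact hx.2 k' h hx'.1
  calc _ ≤ ∫⁻ x, ∑' k, ∑' m : ℕ, (E k m).indicator (fun _ => ((m : ℝ≥0∞) + 1) ^ A) x :=
        lintegral_mono hpt
    _ = ∑' k, ∑' m : ℕ, ((m : ℝ≥0∞) + 1) ^ A * volume (E k m) := by
        rw [lintegral_tsum fun k => (Measurable.tsum fun m =>
          measurable_const.indicator (hEm k m)).aemeasurable]
        refine tsum_congr fun k => ?_
        rw [lintegral_tsum fun m => (measurable_const.indicator (hEm k m)).aemeasurable]
        exact tsum_congr fun m => lintegral_indicator_const (hEm k m) _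
    _ ≤ ∑' k, u / w * D * volume (dyadicIdx n k ⁻¹' F k) := by
        refine ENNReal.tsum_le_tsum fun k => ?_
        rw [hD, ← ENNReal.tsum_mul_left, ← ENNReal.tsum_mul_right]
        refine ENNReal.tsum_le_tsum fun m => ?_
        refine (mul_le_mul_right (hEle k m) _).trans (le_of_eq ?_)
        ring
    _ = u / w * D * volume (⋃ k, dyadicIdx n k ⁻¹' F k) := by
        rw [ENNReal.tsum_mul_left, measure_iUnion hdisj
          fun k => measurable_dyadicIdx k MeasurableSet.of_discrete]
    _ ≤ u / w * D * volume U := by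
        gcongr
        exact iUnion_subset fun k x hx => ⟨k, hx.1⟩

end Decay

section Potential

variable {n : ℕ}

/-- The sum over all dyadic cubes containing a point of a superadditive cube function, normalized
by a power of the volume, is controlled in `L^r` by the corresponding supremum. -/
lemma exists_lintegral_tsum_rpow_le (hn : 1 ≤ n) {θ τ r : ℝ} (hθ : θ < 1) (hτ : 0 < τ)
    (hr : 0 < r) : ∃ C : ℝ≥0∞, C ≠ ∞ ∧ ∀ lam : ℤ → (Fin n → ℤ) → ℝ≥0∞,
      (∀ (k : ℤ) (m : ℕ) (M : Fin n → ℤ),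
        ∑' M' : (dyadicAncestor (n := n) m) ⁻¹' {M}, lam (k + m) M' ≤ lam k M) →
      ∫⁻ x : EuclideanSpace ℝ (Fin n), (∑' k, (lam k (dyadicIdx n k x) /
          volume (dyadicCube n k (dyadicIdx n k x)) ^ θ) ^ (1 / τ)) ^ r ≤
        C * ∫⁻ x : EuclideanSpace ℝ (Fin n), (⨆ k, (lam k (dyadicIdx n k x) /
          volume (dyadicCube n k (dyadicIdx n k x)) ^ θ) ^ (1 / τ)) ^ r := by
  classical
  obtain ⟨C, hC, -, hCb⟩ := exists_tsum_rpow_le hr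
  obtain ⟨D, hD, -, hDN⟩ := exists_tsum_zpow_rpow_le hr
  have hn0 : (0 : ℝ) < n := by exact_mod_cast hn
  have hδ : 0 < n * (1 - θ) := mul_pos hn0 (by linarith)
  set G := ∑' m : ℕ, ((m : ℝ≥0∞) + 1) ^ (2 * r) * (2 : ℝ≥0∞) ^ (-((m : ℝ) * (n * (1 - θ))))
    with hG
  have hGt : G ≠ ∞ := tsum_add_one_rpow_mul_two_rpow_ne_top hδ
  refine ⟨C * (1 + 2 ^ τ * G * D), ENNReal.mul_ne_top hC (ENNReal.add_ne_top.2
    ⟨by norm_num, ENNReal.mul_ne_top (ENNReal.mul_ne_top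
      (ENNReal.rpow_ne_top_of_nonneg hτ.le (by norm_num)) hGt) hD⟩), fun lam hlam => ?_⟩
  simp only [volume_dyadicCube]
  set V : ℤ → ℝ≥0∞ := fun k => (2 : ℝ≥0∞) ^ (-((k : ℝ) * n)) with hV
  set a : ℤ → (Fin n → ℤ) → ℝ≥0∞ := fun k M => (lam k M / V k ^ θ) ^ (1 / τ) with ha
  change ∫⁻ x, (∑' k, a k (dyadicIdx n k x)) ^ r ≤
    C * (1 + 2 ^ τ * G * D) * ∫⁻ x, (⨆ k, a k (dyadicIdx n k x)) ^ r
  have hV0 : ∀ k, V k ^ θ ≠ 0 := fun k => (ENNReal.rpow_pos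
    (ENNReal.rpow_pos (by norm_num) (by norm_num)) (by simp)).ne'
  have hVt : ∀ k, V k ^ θ ≠ ∞ := fun k => by
    simp only [hV, ← ENNReal.rpow_mul]
    simp
  have ham : ∀ k, Measurable fun x => a k (dyadicIdx n k x) := fun k =>
    (measurable_of_countable (a k)).comp (measurable_dyadicIdx k)
  set N : EuclideanSpace ℝ (Fin n) → ℝ≥0∞ := fun x => ⨆ k, a k (dyadicIdx n k x) with hN
  have hNm : Measurable N := Measurable.iSup ham
  set S : ℤ → ℤ → Set (Fin n → ℤ) := fun j k =>
    {M | (2 : ℝ≥0∞) ^ j ≤ a k M ∧ a k M < 2 ^ (j + 1)} with hS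
  set cnt : ℤ → EuclideanSpace ℝ (Fin n) → ℝ≥0∞ := fun j x =>
    ∑' k, if dyadicIdx n k x ∈ S j k then (1 : ℝ≥0∞) else 0 with hcnt
  have hcntm : ∀ j, Measurable (cnt j) := fun j => Measurable.tsum fun k =>
    Measurable.ite (measurable_dyadicIdx k MeasurableSet.of_discrete)
      measurable_const measurable_const
  have hpt : ∀ x, (∑' k, a k (dyadicIdx n k x)) ^ r ≤
      C * (N x ^ r + ∑' j : ℤ, ((2 : ℝ≥0∞) ^ j) ^ r * cnt j x ^ (2 * r)) := by
    intro x
    refine (hCb fun k => a k (dyadicIdx n k x)).trans (le_of_eq ?_)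
    congr!
  have hcount : ∀ j, ∫⁻ x, cnt j x ^ (2 * r) ≤
      2 ^ τ * G * volume {x | (2 : ℝ≥0∞) ^ j ≤ N x} := by
    intro j
    have hj0 : (2 : ℝ≥0∞) ^ j ≠ 0 := (ENNReal.zpow_pos two_ne_zero (by norm_num) j).ne'
    have hjt : (2 : ℝ≥0∞) ^ j ≠ ∞ := ENNReal.zpow_ne_top two_ne_zero (by norm_num) j
    have hw0 : ((2 : ℝ≥0∞) ^ j) ^ τ ≠ 0 := (ENNReal.rpow_pos (pos_iff_ne_zero.2 hj0) hjt).ne'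
    have hwt : ((2 : ℝ≥0∞) ^ j) ^ τ ≠ ∞ := ENNReal.rpow_ne_top_of_nonneg hτ.le hjt
    have hu : ((2 : ℝ≥0∞) ^ (j + 1)) ^ τ = 2 ^ τ * ((2 : ℝ≥0∞) ^ j) ^ τ := by
      rw [ENNReal.zpow_add two_ne_zero (by norm_num), zpow_one,
        ENNReal.mul_rpow_of_nonneg _ _ hτ.le, mul_comm]
    have h1 := lintegral_count_rpow_le (θ := θ) hn hlam hw0 hwt
      (u := ((2 : ℝ≥0∞) ^ (j + 1)) ^ τ)
      (ENNReal.rpow_le_rpow (ENNReal.zpow_le_of_le (by norm_num) (by omega)) hτ.le)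
      (A := 2 * r) (by positivity) (S j)
      (fun k M hM => by
        have := hM.1
        rw [ha, one_div, ENNReal.le_rpow_inv_iff hτ] at this
        exact (ENNReal.le_div_iff_mul_le (Or.inl (hV0 k)) (Or.inl (hVt k))).1 this)
      (fun k M hM => by
        have := hM.2.le
        rw [ha, one_div, ENNReal.rpow_inv_le_iff hτ] at this
        exact (ENNReal.div_le_iff_le_mul (Or.inl (hV0 k)) (Or.inl (hVt k))).1 this)
    rw [hu, ENNReal.mul_div_cancel_right hw0 hwt] at h1
    refine h1.trans ?_
    gcongr
    rintro ⟨k, hk⟩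
    exact hk.1.trans (le_iSup (fun k => a k (dyadicIdx n k _)) k)
  calc ∫⁻ x, (∑' k, a k (dyadicIdx n k x)) ^ r
      ≤ ∫⁻ x, C * (N x ^ r + ∑' j : ℤ, ((2 : ℝ≥0∞) ^ j) ^ r * cnt j x ^ (2 * r)) :=
        lintegral_mono hpt
    _ = C * ((∫⁻ x, N x ^ r) + ∑' j : ℤ, ((2 : ℝ≥0∞) ^ j) ^ r * ∫⁻ x, cnt j x ^ (2 * r)) := by
        rw [lintegral_const_mul' _ _ hC, lintegral_add_left (hNm.pow_const r),
          lintegral_tsum fun j => (((hcntm j).pow_const _).const_mul _).aemeasurable]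
        congr 2
        exact tsum_congr fun j => lintegral_const_mul _ ((hcntm j).pow_const _)
    _ ≤ C * ((∫⁻ x, N x ^ r) + ∑' j : ℤ, ((2 : ℝ≥0∞) ^ j) ^ r *
          (2 ^ τ * G * volume {x | (2 : ℝ≥0∞) ^ j ≤ N x})) := by
        gcongr with j
        exact hcount j
    _ = C * ((∫⁻ x, N x ^ r) + 2 ^ τ * G * ∫⁻ x, ∑' j : ℤ,
          (if (2 : ℝ≥0∞) ^ j ≤ N x then ((2 : ℝ≥0∞) ^ j) ^ r else 0)) := by
        have hm : ∀ j : ℤ, MeasurableSet {x | (2 : ℝ≥0∞) ^ j ≤ N x} := fun j =>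
          measurableSet_le measurable_const hNm
        rw [lintegral_tsum fun j =>
          (Measurable.ite (hm j) measurable_const measurable_const).aemeasurable,
          ← ENNReal.tsum_mul_left (a := 2 ^ τ * G)]
        congr 2
        refine tsum_congr fun j => ?_
        have : (fun x => if (2 : ℝ≥0∞) ^ j ≤ N x then ((2 : ℝ≥0∞) ^ j) ^ r else 0) =
            {x | (2 : ℝ≥0∞) ^ j ≤ N x}.indicator fun _ => ((2 : ℝ≥0∞) ^ j) ^ r := by
          ext x
          simp [indicator_apply]
        rw [this, lintegral_indicator_const (hm j)]
        ring
    _ ≤ C * ((∫⁻ x, N x ^ r) + 2 ^ τ * G * ∫⁻ x, D * N x ^ r) := by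
        gcongr with x
        exact hDN (N x)
    _ = C * (1 + 2 ^ τ * G * D) * ∫⁻ x, N x ^ r := by
        rw [lintegral_const_mul' _ _ hD]
        ring

lemma tsum_indicator_dyadicCube (f : ℤ → (Fin n → ℤ) → ℝ≥0∞) (x : EuclideanSpace ℝ (Fin n)) :
    ∑' km : ℤ × (Fin n → ℤ), (dyadicCube n km.1 km.2).indicator (fun _ => f km.1 km.2) x =
      ∑' k, f k (dyadicIdx n k x) := by
  rw [ENNReal.tsum_prod']
  refine tsum_congr fun k => ?_
  rw [tsum_eq_single (dyadicIdx n k x)]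
  · exact indicator_of_mem (mem_dyadicCube_iff.2 rfl) _
  · exact fun M hM => indicator_of_notMem (fun h => hM (mem_dyadicCube_iff.1 h).symm) _

lemma iSup_dyadicCube (f : ℤ → (Fin n → ℤ) → ℝ≥0∞) (x : EuclideanSpace ℝ (Fin n)) :
    ⨆ (km : ℤ × (Fin n → ℤ)) (_ : x ∈ dyadicCube n km.1 km.2), f km.1 km.2 =
      ⨆ k, f k (dyadicIdx n k x) := by
  refine le_antisymm (iSup₂_le fun km h => ?_) (iSup_le fun k => ?_)
  · rw [← mem_dyadicCube_iff.1 h]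
    exact le_iSup (fun k => f k (dyadicIdx n k x)) km.1
  · exact le_iSup₂_of_le (k, dyadicIdx n k x) (mem_dyadicCube_iff.2 rfl) le_rfl

end Potential

/-- Dyadic enhanced Wolff inequality: for `r > n(p−1)/(n−αp)`,
`∫ (K^d_{α,p,q}σ)^r dx ≈ ∫ sup_{Q ∋ x} (κ(Q)^{q(p−1)/(p−1−q)}/|Q|^{1−αp/n})^{r/(p−1)} dx`. -/
theorem dyadic_enhanced_wolff_inequality (n : ℕ) (hn : 1 ≤ n) (α p q r : ℝ)
    (hp : 1 < p) (hq0 : 0 < q) (hqp : q < p - 1)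
    (hα0 : 0 < α) (hαp : α < n / p)
    (hr : (n : ℝ) * (p - 1) / ((n : ℝ) - α * p) < r) :
    ∃ c C : ℝ, 0 < c ∧ c ≤ C ∧
      ∀ σ : Measure (EuclideanSpace ℝ (Fin n)), IsLocallyFiniteMeasure σ →
        (ENNReal.ofReal c *
            (∫⁻ x, ⨆ (km : ℤ × (Fin n → ℤ)) (_ : x ∈ dyadicCube n km.1 km.2),
              (embC n α p q σ (dyadicCube n km.1 km.2) ^ (q * (p - 1) / (p - 1 - q)) /
                volume (dyadicCube n km.1 km.2) ^ (1 - α * p / (n : ℝ))) ^ (r / (p - 1))) ≤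
          ∫⁻ x, intKd n α p q σ x ^ r) ∧
        ((∫⁻ x, intKd n α p q σ x ^ r) ≤
          ENNReal.ofReal C *
            (∫⁻ x, ⨆ (km : ℤ × (Fin n → ℤ)) (_ : x ∈ dyadicCube n km.1 km.2),
              (embC n α p q σ (dyadicCube n km.1 km.2) ^ (q * (p - 1) / (p - 1 - q)) /
                volume (dyadicCube n km.1 km.2) ^ (1 - α * p / (n : ℝ))) ^ (r / (p - 1)))) := by
  have hp1 : 0 < p - 1 := by linarith
  have hn0 : (0 : ℝ) < n := by exact_mod_cast hn
  have hαpn : α * p < n := (lt_div_iff₀ (by linarith)).1 hαp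
  have hr0 : 0 < r := lt_trans (div_pos (mul_pos hn0 hp1) (by linarith)) hr
  have hθ : 1 - α * p / n < 1 := by
    have : 0 < α * p / n := by positivity
    linarith
  obtain ⟨C, hC, hCle⟩ := exists_lintegral_tsum_rpow_le hn hθ hp1 hr0
  refine ⟨1, max 1 C.toReal, one_pos, le_max_left _ _, fun σ _ => ?_⟩
  set a : ℤ → (Fin n → ℤ) → ℝ≥0∞ := fun k M =>
    (embC n α p q σ (dyadicCube n k M) ^ (q * (p - 1) / (p - 1 - q)) /
      volume (dyadicCube n k M) ^ (1 - α * p / (n : ℝ))) ^ (1 / (p - 1)) with ha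
  have hK : ∀ x, intKd n α p q σ x = ∑' k, a k (dyadicIdx n k x) :=
    tsum_indicator_dyadicCube a
  have hsup : ∀ x, ⨆ (km : ℤ × (Fin n → ℤ)) (_ : x ∈ dyadicCube n km.1 km.2),
      (embC n α p q σ (dyadicCube n km.1 km.2) ^ (q * (p - 1) / (p - 1 - q)) /
        volume (dyadicCube n km.1 km.2) ^ (1 - α * p / (n : ℝ))) ^ (r / (p - 1)) =
      (⨆ k, a k (dyadicIdx n k x)) ^ r := by
    intro x
    have h1 : (⨆ k, a k (dyadicIdx n k x)) ^ r = ⨆ k, a k (dyadicIdx n k x) ^ r :=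
      (ENNReal.orderIsoRpow r hr0).map_iSup _
    rw [h1, ← iSup_dyadicCube (fun k M => a k M ^ r)]
    simp only [ha, ← ENNReal.rpow_mul, one_div_mul_eq_div]
  simp only [hsup, hK]
  constructor
  · rw [ENNReal.ofReal_one, one_mul]
    gcongr with x
    exact iSup_le fun k => ENNReal.le_tsum k
  · refine (hCle (fun k M => embC n α p q σ (dyadicCube n k M) ^ (q * (p - 1) / (p - 1 - q)))
      fun k m M => ?_).trans ?_
    · refine tsum_embC_rpow_le hp hq0 hqp
        (A := fun M' : (dyadicAncestor (n := n) m) ⁻¹' {M} => dyadicCube n (k + m) M')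
        (fun M' => measurableSet_dyadicCube _ _)
        (fun M' M'' h => disjoint_dyadicCube (Subtype.coe_injective.ne h)) fun M' => ?_
      obtain ⟨M', rfl⟩ := M'
      exact dyadicCube_subset_dyadicCube_ancestor k m M'
    · gcongr
      exact ENNReal.le_ofReal_iff_toReal_le hC (by positivity) |>.2 (le_max_right _ _)
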